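/- arXiv:1604.02631 — 3 statements merged into one kernel-verified Lean document; each statement's English description precedes it below -/
import Mathlib

section
/- Let (Ω, 𝓕, P) be a probability space, W a measurable space, f : [a,b]^M × W → [a,b]^M a transition mapping, and K_sup < ∞ a constant such that ‖f(x, w) − f(x', w)‖₁ ≤ K_sup ‖x − x'‖₁ for all x, x' ∈ [a,b]^M and all w ∈ W. Let X_0 be a random vector with X_0 ∈ [a,b]^M almost surely, (W_t)_{t≥1} a W-valued process, and define X_t := f(X_{t−1}, W_t) for t ≥ 1, together with the Markovian quantization X_0^L := Q_L(X_0) and X_t^L := Q_L(f(X_{t−1}^L, W_t)) for t ≥ 1. Then for every t ∈ ℕ, esssup_{ω∈Ω} ‖X_t^L(ω) − X_t(ω)‖₁ ≤ (M(b−a)/(2L)) · Σ_{j=0}^{t} K_sup^j, and hence for each fixed t this quantity tends to 0 as L → ∞ (convergence pointwise in t, uniformly almost everywhere in ω). (First part of the paper's Lemma 4, Uniform Convergence of Markovian State Quantizations.) -/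
open Filter Topology MeasureTheory

/-- Uniform scalar midpoint quantizer on `[a,b]` with `L` levels. -/
noncomputable def scalarQuant (a b : ℝ) (L : ℕ) (x : ℝ) : ℝ :=
  a + (((min ⌊(L : ℝ) * (x - a) / (b - a)⌋ ((L : ℤ) - 1) : ℤ) : ℝ) + 1 / 2) * (b - a) / L

/-- Uniform vector quantizer on `[a,b]^M`, applied coordinatewise. -/
noncomputable def vecQuant (a b : ℝ) (L M : ℕ) (x : Fin M → ℝ) : Fin M → ℝ :=
  fun i => scalarQuant a b L (x i)

/-- Cell of the uniform partition containing `x`, in the normalized coordinate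
`y = L (x - a) / (b - a)`. -/
lemma exists_scalarQuant_eq {a b x : ℝ} (hab : a < b) {L : ℕ} (hL : 1 ≤ L)
    (hx : x ∈ Set.Icc a b) :
    ∃ n y : ℝ, 0 ≤ n ∧ n + 1 ≤ L ∧ n ≤ y ∧ y ≤ n + 1 ∧
      x = a + y * ((b - a) / L) ∧ scalarQuant a b L x = a + (n + 1 / 2) * ((b - a) / L) := by
  have hL' : (0 : ℝ) < L := by exact_mod_cast hL
  have hba : 0 < b - a := sub_pos.2 hab
  set y : ℝ := (L : ℝ) * (x - a) / (b - a) with hy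
  have hy0 : 0 ≤ y := div_nonneg (mul_nonneg hL'.le (sub_nonneg.2 hx.1)) hba.le
  have hyL : y ≤ L := by
    rw [hy, div_le_iff₀ hba]
    exact mul_le_mul_of_nonneg_left (by linarith [hx.2]) hL'.le
  refine ⟨((min ⌊y⌋ ((L : ℤ) - 1) : ℤ) : ℝ), y, ?_, ?_, ?_, ?_, ?_, ?_⟩
  · have : 0 ≤ min ⌊y⌋ ((L : ℤ) - 1) := le_min (Int.floor_nonneg.2 hy0) (by lia)
    exact_mod_cast this
  · have : min ⌊y⌋ ((L : ℤ) - 1) + 1 ≤ L := by lia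
    exact_mod_cast this
  · exact le_trans (by exact_mod_cast min_le_left _ _) (Int.floor_le y)
  · rcases min_choice ⌊y⌋ ((L : ℤ) - 1) with h | h <;> rw [h]
    · exact (Int.lt_floor_add_one y).le
    · push_cast
      linarith
  · rw [hy]
    field_simp
    ring
  · rw [scalarQuant, mul_div_assoc]

lemma scalarQuant_mem_Icc {a b x : ℝ} (hab : a < b) {L : ℕ} (hL : 1 ≤ L)
    (hx : x ∈ Set.Icc a b) : scalarQuant a b L x ∈ Set.Icc a b := by
  obtain ⟨n, y, hn0, hnL, -, -, -, hq⟩ := exists_scalarQuant_eq hab hL hx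
  have hL' : (0 : ℝ) < L := by exact_mod_cast hL
  have hd : 0 < (b - a) / L := div_pos (sub_pos.2 hab) hL'
  have hLd : L * ((b - a) / L) = b - a := by field_simp
  rw [hq]
  constructor <;> nlinarith

lemma abs_scalarQuant_sub_le {a b x : ℝ} (hab : a < b) {L : ℕ} (hL : 1 ≤ L)
    (hx : x ∈ Set.Icc a b) : |scalarQuant a b L x - x| ≤ (b - a) / (2 * L) := by
  obtain ⟨n, y, -, -, hny, hyn, hxy, hq⟩ := exists_scalarQuant_eq hab hL hx
  have hL' : (0 : ℝ) < L := by exact_mod_cast hL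
  have hd : 0 < (b - a) / L := div_pos (sub_pos.2 hab) hL'
  have h2 : (b - a) / (2 * L) = 1 / 2 * ((b - a) / L) := by field_simp
  have hsub : scalarQuant a b L x - x = (n + 1 / 2 - y) * ((b - a) / L) := by
    rw [hq]
    linear_combination -hxy
  rw [hsub, h2, abs_mul, abs_of_pos hd]
  exact mul_le_mul_of_nonneg_right (abs_le.2 ⟨by linarith, by linarith⟩) hd.le

lemma sum_abs_vecQuant_sub_le {a b : ℝ} (hab : a < b) {L M : ℕ} (hL : 1 ≤ L)
    {x : Fin M → ℝ} (hx : ∀ i, x i ∈ Set.Icc a b) :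
    ∑ i, |vecQuant a b L M x i - x i| ≤ (M : ℝ) * (b - a) / (2 * L) := by
  calc ∑ i, |vecQuant a b L M x i - x i|
      ≤ ∑ _i : Fin M, (b - a) / (2 * L) :=
        Finset.sum_le_sum fun i _ => abs_scalarQuant_sub_le hab hL (hx i)
    _ = (M : ℝ) * (b - a) / (2 * L) := by simp [mul_div_assoc]

/-- Pathwise error bound for the quantized recursion driven by the transition maps `g t`. -/
lemma sum_abs_quantized_orbit_sub_le {a b : ℝ} (hab : a < b) {L M : ℕ} (hL : 1 ≤ L)
    {K : ℝ} (hK : 0 ≤ K) (g : ℕ → (Fin M → ℝ) → (Fin M → ℝ))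
    (hrange : ∀ t x, (∀ i, x i ∈ Set.Icc a b) → ∀ i, g t x i ∈ Set.Icc a b)
    (hLip : ∀ t x x', (∀ i, x i ∈ Set.Icc a b) → (∀ i, x' i ∈ Set.Icc a b) →
      ∑ i, |g t x i - g t x' i| ≤ K * ∑ i, |x i - x' i|)
    {x xL : ℕ → Fin M → ℝ} (hx0 : ∀ i, x 0 i ∈ Set.Icc a b)
    (hx : ∀ t, x (t + 1) = g t (x t)) (hxL0 : xL 0 = vecQuant a b L M (x 0))
    (hxL : ∀ t, xL (t + 1) = vecQuant a b L M (g t (xL t))) (t : ℕ) :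
    ∑ i, |xL t i - x t i| ≤
      (M : ℝ) * (b - a) / (2 * L) * ∑ j ∈ Finset.range (t + 1), K ^ j := by
  have hmem : ∀ t i, x t i ∈ Set.Icc a b := by
    intro t
    induction t with
    | zero => exact hx0
    | succ t ih => exact hx t ▸ hrange t _ ih
  have hmemL : ∀ t i, xL t i ∈ Set.Icc a b := by
    intro t
    induction t with
    | zero => exact fun i => hxL0 ▸ scalarQuant_mem_Icc hab hL (hx0 i)
    | succ t ih => exact fun i => hxL t ▸ scalarQuant_mem_Icc hab hL (hrange t _ ih i)
  induction t with
  | zero => simpa [hxL0] using sum_abs_vecQuant_sub_le hab hL hx0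
  | succ t ih =>
    have hq := sum_abs_vecQuant_sub_le hab hL (hrange t _ (hmemL t))
    have hl := (hLip t _ _ (hmemL t) (hmem t)).trans (mul_le_mul_of_nonneg_left ih hK)
    calc ∑ i, |xL (t + 1) i - x (t + 1) i|
        ≤ ∑ i, (|vecQuant a b L M (g t (xL t)) i - g t (xL t) i| +
            |g t (xL t) i - g t (x t) i|) := by
          rw [hxL, hx]
          exact Finset.sum_le_sum fun i _ => abs_sub_le _ _ _
      _ ≤ (M : ℝ) * (b - a) / (2 * L) +
            K * ((M : ℝ) * (b - a) / (2 * L) * ∑ j ∈ Finset.range (t + 1), K ^ j) := by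
          rw [Finset.sum_add_distrib]
          exact add_le_add hq hl
      _ = (M : ℝ) * (b - a) / (2 * L) * ∑ j ∈ Finset.range (t + 1 + 1), K ^ j := by
          rw [geom_sum_succ (n := t + 1)]
          ring

lemma essSup_mem_Icc_of_ae {Ω : Type*} [MeasurableSpace Ω] {P : Measure Ω} [NeZero P]
    {u : Ω → ℝ} {c C : ℝ} (hu : ∀ᵐ ω ∂P, u ω ∈ Set.Icc c C) :
    essSup u P ∈ Set.Icc c C := by
  have hlo : ∀ᵐ ω ∂P, c ≤ u ω := hu.mono fun _ h => h.1
  have hhi : ∀ᵐ ω ∂P, u ω ≤ C := hu.mono fun _ h => h.2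
  exact ⟨le_limsup_of_frequently_le hlo.frequently (isBoundedUnder_of_eventually_le hhi),
    limsup_le_of_le (isBoundedUnder_of_eventually_ge hlo).isCoboundedUnder_le hhi⟩

/-- **Lemma 4, first part (Uniform Convergence of Markovian State Quantizations).**
With `X_t = f(X_{t−1}, W_t)` for a transition mapping `f` on `[a,b]^M` that is Lipschitz
in its first argument with constant `K_sup` (uniformly in the noise), and with the
Markovian quantization `X_0^L = Q_L(X_0)`, `X_t^L = Q_L(f(X_{t−1}^L, W_t))`, one has
`esssup_ω ‖X_t^L(ω) − X_t(ω)‖₁ ≤ (M(b−a)/(2L)) Σ_{j=0}^t K_sup^j` for every `t`,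
hence for each fixed `t` this tends to `0` as `L → ∞`. -/
theorem uniform_convergence_of_markovian_state_quantizations_pointwise
    {Ω : Type*} [MeasurableSpace Ω] (P : Measure Ω) [IsProbabilityMeasure P]
    {W : Type*} [MeasurableSpace W]
    (a b : ℝ) (hab : a < b) (M : ℕ) (hM : 1 ≤ M)
    (f : (Fin M → ℝ) → W → (Fin M → ℝ)) (Ksup : ℝ) (hKsup : 0 ≤ Ksup)
    (hrange : ∀ (x : Fin M → ℝ) (w : W), (∀ i, x i ∈ Set.Icc a b) →
      ∀ i, f x w i ∈ Set.Icc a b)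
    (hLip : ∀ (x x' : Fin M → ℝ) (w : W),
      ∑ i, |f x w i - f x' w i| ≤ Ksup * ∑ i, |x i - x' i|)
    (Wt : ℕ → Ω → W)
    (X : ℕ → Ω → (Fin M → ℝ))
    (hX0 : ∀ᵐ ω ∂P, ∀ i, X 0 ω i ∈ Set.Icc a b)
    (hX : ∀ (t : ℕ) (ω : Ω), X (t + 1) ω = f (X t ω) (Wt (t + 1) ω))
    (XL : ℕ → ℕ → Ω → (Fin M → ℝ))
    (hXL0 : ∀ (L : ℕ) (ω : Ω), XL L 0 ω = vecQuant a b L M (X 0 ω))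
    (hXL : ∀ (L t : ℕ) (ω : Ω),
      XL L (t + 1) ω = vecQuant a b L M (f (XL L t ω) (Wt (t + 1) ω))) :
    (∀ L : ℕ, 1 ≤ L → ∀ t : ℕ,
      essSup (fun ω => ∑ i, |XL L t ω i - X t ω i|) P ≤
        (M : ℝ) * (b - a) / (2 * L) * ∑ j ∈ Finset.range (t + 1), Ksup ^ j) ∧
    (∀ t : ℕ,
      Tendsto (fun L : ℕ => essSup (fun ω => ∑ i, |XL L t ω i - X t ω i|) P)
        atTop (𝓝 0)) := by
  have key : ∀ L : ℕ, 1 ≤ L → ∀ t : ℕ,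
      essSup (fun ω => ∑ i, |XL L t ω i - X t ω i|) P ∈ Set.Icc 0
        ((M : ℝ) * (b - a) / (2 * L) * ∑ j ∈ Finset.range (t + 1), Ksup ^ j) := by
    intro L hL t
    apply essSup_mem_Icc_of_ae
    filter_upwards [hX0] with ω hω
    exact ⟨Finset.sum_nonneg fun i _ => abs_nonneg _,
      sum_abs_quantized_orbit_sub_le hab hL hKsup (fun t x => f x (Wt (t + 1) ω))
        (fun t x => hrange x _) (fun t x x' _ _ => hLip x x' _) (x := fun t => X t ω)
        (xL := fun t => XL L t ω) hω (fun t => hX t ω) (hXL0 L ω) (fun t => hXL L t ω) t⟩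
  refine ⟨fun L hL t => (key L hL t).2, fun t => ?_⟩
  have hbound : Tendsto (fun L : ℕ => (M : ℝ) * (b - a) / (2 * L) *
      ∑ j ∈ Finset.range (t + 1), Ksup ^ j) atTop (𝓝 0) := by
    have h2L : Tendsto (fun L : ℕ => 2 * (L : ℝ)) atTop atTop :=
      tendsto_natCast_atTop_atTop.const_mul_atTop two_pos
    simpa using (h2L.const_div_atTop ((M : ℝ) * (b - a))).mul_const
      (∑ j ∈ Finset.range (t + 1), Ksup ^ j)
  refine tendsto_of_tendsto_of_tendsto_of_le_of_le' tendsto_const_nhds hbound ?_ ?_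
  · filter_upwards [eventually_ge_atTop 1] with L hL using (key L hL t).1
  · filter_upwards [eventually_ge_atTop 1] with L hL using (key L hL t).2
end

section
/- For every t ≥ 1, the unnormalized filter vector satisfies the linear recursion E_t = D_t(Y_t) · 𝐏 · E_{t−1} almost surely; moreover E_0 = D_0(Y_0) · E[Z_0] almost surely. (Core recursion of the paper's Theorem 3, The Markovian Filter.) -/
open MeasureTheory ProbabilityTheory

/-- The `i`-th standard basis vector of `ℝ^L`. -/
def stdBasis (L : ℕ) (i : Fin L) : Fin L → ℝ := fun j => if j = i then 1 else 0

/-- The σ-algebra generated by the random variables `Z_0, …, Z_t`. -/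
def pastFilt {Ω α : Type*} [MeasurableSpace α] (Z : ℕ → Ω → α) (t : ℕ) :
    MeasurableSpace Ω :=
  ⨆ s ∈ Set.Iic t, MeasurableSpace.comap (Z s) inferInstance

theorem condExp_mul_eq_mul_integral_of_indep {Ω : Type*} {m₁ m₂ m₀ : MeasurableSpace Ω}
    {P : Measure Ω} [IsProbabilityMeasure P] (h₁ : m₁ ≤ m₀) (h₂ : m₂ ≤ m₀)
    (hindep : Indep m₁ m₂ P) {X V : Ω → ℝ} (hX : StronglyMeasurable[m₁] X)
    (hV : StronglyMeasurable[m₂] V) (hXi : Integrable X P)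
    (hXV : Integrable (fun ω => X ω * V ω) P) :
    P[fun ω => X ω * V ω | m₂] =ᵐ[P] fun ω => (∫ x, X x ∂P) * V ω := by
  have e₁ : P[fun ω => X ω * V ω | m₂] =ᵐ[P] fun ω => (P[X | m₂]) ω * V ω :=
    condExp_mul_of_stronglyMeasurable_right hV hXV hXi
  have e₂ := condExp_indep_eq h₁ h₂ hX hindep
  filter_upwards [e₁, e₂] with ω hω₁ hω₂
  rw [hω₁, hω₂]

theorem integrable_of_measurable_of_abs_le {Ω : Type*} [MeasurableSpace Ω] {P : Measure Ω}
    [IsFiniteMeasure P] {X : Ω → ℝ} (hX : Measurable X) {C : ℝ} (hC : ∀ ω, |X ω| ≤ C) :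
    Integrable X P :=
  Integrable.of_bound hX.aestronglyMeasurable C (Filter.Eventually.of_forall hC)

theorem measurable_pastFilt {Ω α : Type*} [MeasurableSpace α] (Z : ℕ → Ω → α) {s t : ℕ}
    (hst : s ≤ t) : Measurable[pastFilt Z t] (Z s) :=
  (comap_measurable (Z s)).mono
    (le_iSup₂_of_le (f := fun s (_ : s ∈ Set.Iic t) => MeasurableSpace.comap (Z s) inferInstance)
      s hst le_rfl) le_rfl

theorem pastFilt_le_iSup {Ω α : Type*} [MeasurableSpace α] (Z : ℕ → Ω → α) (t : ℕ) :
    pastFilt Z t ≤ ⨆ s, MeasurableSpace.comap (Z s) inferInstance :=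
  iSup₂_le fun s _ => le_iSup (fun s => MeasurableSpace.comap (Z s) inferInstance) s

theorem iSup_comap_le {Ω α : Type*} [MeasurableSpace Ω] [MeasurableSpace α] {Z : ℕ → Ω → α}
    (hZ : ∀ t, Measurable (Z t)) :
    ⨆ t, MeasurableSpace.comap (Z t) inferInstance ≤ (inferInstance : MeasurableSpace Ω) :=
  iSup_le fun t => (hZ t).comap_le

theorem stdBasis_mul_apply {L : ℕ} {z : Fin L → ℝ} (hz : ∃ i, z = stdBasis L i) (k : Fin L)
    (f : (Fin L → ℝ) → ℝ) : z k * f z = z k * f (stdBasis L k) := by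
  obtain ⟨i, rfl⟩ := hz
  by_cases h : k = i
  · rw [h]
  · simp [stdBasis, h]

theorem apply_eq_sum_stdBasis {L : ℕ} {z : Fin L → ℝ} (hz : ∃ i, z = stdBasis L i)
    (f : (Fin L → ℝ) → ℝ) : f z = ∑ k, z k * f (stdBasis L k) := by
  obtain ⟨i, rfl⟩ := hz
  simp [stdBasis]

theorem abs_apply_le_one {L : ℕ} {z : Fin L → ℝ} (hz : ∃ i, z = stdBasis L i) (k : Fin L) :
    |z k| ≤ 1 := by
  obtain ⟨i, rfl⟩ := hz
  by_cases h : k = i <;> simp [stdBasis, h]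

/-- Expansion of a likelihood product over all paths of the chain. -/
theorem prod_eq_sum_paths {L N : ℕ} {Ω : Type*} {Z : ℕ → Ω → (Fin L → ℝ)}
    (hZ : ∀ t ω, ∃ i : Fin L, Z t ω = stdBasis L i) (Y : ℕ → Ω → (Fin N → ℝ))
    (g : ℕ → (Fin L → ℝ) → (Fin N → ℝ) → ℝ) (n : ℕ) (ω : Ω) :
    ∏ s ∈ Finset.range n, g s (Z s ω) (Y s ω) =
      ∑ a : Fin n → Fin L,
        (∏ s : Fin n, Z s ω (a s)) * ∏ s : Fin n, g s (stdBasis L (a s)) (Y s ω) := by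
  rw [Finset.prod_range]
  calc ∏ s : Fin n, g s (Z s ω) (Y s ω)
      = ∏ s : Fin n, ∑ k, Z s ω k * g s (stdBasis L k) (Y s ω) :=
        Finset.prod_congr rfl fun s _ =>
          apply_eq_sum_stdBasis (hZ s ω) fun z => g s z (Y s ω)
    _ = _ := by
        rw [Finset.prod_univ_sum, Fintype.piFinset_univ]
        simp_rw [Finset.prod_mul_distrib]

theorem abs_prod_paths_le_one {L : ℕ} {Ω : Type*} {Z : ℕ → Ω → (Fin L → ℝ)}
    (hZ : ∀ t ω, ∃ i : Fin L, Z t ω = stdBasis L i) {n : ℕ} (a : Fin n → Fin L) (ω : Ω) :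
    |∏ s : Fin n, Z s ω (a s)| ≤ 1 := by
  rw [Finset.abs_prod]
  exact Finset.prod_le_one (fun _ _ => abs_nonneg _) fun s _ => abs_apply_le_one (hZ s ω) (a s)

theorem condExp_mul_prod_eq_sum_paths {Ω : Type*} {m₀ : MeasurableSpace Ω} (P : Measure Ω)
    [IsProbabilityMeasure P] {L N : ℕ}
    {Z : ℕ → Ω → (Fin L → ℝ)} (hmZ : ∀ t, Measurable (Z t))
    (hZ : ∀ t ω, ∃ i : Fin L, Z t ω = stdBasis L i)
    {Y : ℕ → Ω → (Fin N → ℝ)} (hmY : ∀ t, Measurable (Y t))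
    (hindep : Indep (⨆ t : ℕ, MeasurableSpace.comap (Z t) inferInstance)
                    (⨆ t : ℕ, MeasurableSpace.comap (Y t) inferInstance) P)
    {g : ℕ → (Fin L → ℝ) → (Fin N → ℝ) → ℝ} {c : ℕ → ℝ}
    (hmg : ∀ t, Measurable (Function.uncurry (g t)))
    (hg : ∀ t z y, g t z y ∈ Set.Icc (0 : ℝ) (c t))
    {t u : ℕ} (htu : t ≤ u) (r : ℕ) (k : Fin L) :
    (P[fun ω => Z r ω k * ∏ s ∈ Finset.range (t + 1), g s (Z s ω) (Y s ω) | pastFilt Y u])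
      =ᵐ[P] fun ω => ∑ a : Fin (t + 1) → Fin L,
        (∫ x, Z r x k * ∏ s : Fin (t + 1), Z s x (a s) ∂P) *
          ∏ s : Fin (t + 1), g s (stdBasis L (a s)) (Y s ω) := by
  have hYle : pastFilt Y u ≤ m₀ := (pastFilt_le_iSup Y u).trans (iSup_comap_le hmY)
  have hXm (a : Fin (t + 1) → Fin L) :
      Measurable[⨆ t, MeasurableSpace.comap (Z t) inferInstance]
        fun ω => Z r ω k * ∏ s : Fin (t + 1), Z s ω (a s) := by
    have hZs (s : ℕ) : Measurable[⨆ t, MeasurableSpace.comap (Z t) inferInstance] (Z s) :=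
      (measurable_pastFilt Z le_rfl).mono (pastFilt_le_iSup Z s) le_rfl
    exact ((measurable_pi_apply k).comp (hZs r)).mul
      (Finset.measurable_prod _ fun s _ => (measurable_pi_apply (a s)).comp (hZs s))
  have hXb (a : Fin (t + 1) → Fin L) (ω : Ω) : |Z r ω k * ∏ s : Fin (t + 1), Z s ω (a s)| ≤ 1 := by
    rw [abs_mul]
    exact mul_le_one₀ (abs_apply_le_one (hZ r ω) k) (abs_nonneg _) (abs_prod_paths_le_one hZ a ω)
  have hVm (a : Fin (t + 1) → Fin L) :
      Measurable[pastFilt Y u] fun ω => ∏ s : Fin (t + 1), g s (stdBasis L (a s)) (Y s ω) :=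
    Finset.measurable_prod _ fun s _ => ((hmg s).comp measurable_prodMk_left).comp
      (measurable_pastFilt Y ((Nat.lt_succ_iff.mp s.2).trans htu))
  have hVb (a : Fin (t + 1) → Fin L) (ω : Ω) :
      |∏ s : Fin (t + 1), g s (stdBasis L (a s)) (Y s ω)| ≤ ∏ s : Fin (t + 1), c s := by
    rw [Finset.abs_prod]
    refine Finset.prod_le_prod (fun _ _ => abs_nonneg _) fun s _ => ?_
    rw [abs_of_nonneg (hg _ _ _).1]
    exact (hg _ _ _).2
  have hXm₀ (a : Fin (t + 1) → Fin L) := (hXm a).mono (iSup_comap_le hmZ) le_rfl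
  have hXVi (a : Fin (t + 1) → Fin L) : Integrable (fun ω => (Z r ω k * ∏ s : Fin (t + 1), Z s ω (a s)) *
      ∏ s : Fin (t + 1), g s (stdBasis L (a s)) (Y s ω)) P := by
    refine integrable_of_measurable_of_abs_le ((hXm₀ a).mul ((hVm a).mono hYle le_rfl))
      (C := 1 * ∏ s : Fin (t + 1), c s) fun ω => ?_
    rw [abs_mul]
    exact mul_le_mul (hXb a ω) (hVb a ω) (abs_nonneg _) zero_le_one
  have hexp : (fun ω => Z r ω k * ∏ s ∈ Finset.range (t + 1), g s (Z s ω) (Y s ω)) =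
      ∑ a : Fin (t + 1) → Fin L, fun ω => (Z r ω k * ∏ s : Fin (t + 1), Z s ω (a s)) *
        ∏ s : Fin (t + 1), g s (stdBasis L (a s)) (Y s ω) := by
    ext ω
    simp only [Finset.sum_apply, prod_eq_sum_paths hZ Y g, Finset.mul_sum, mul_assoc]
  have hterm (a : Fin (t + 1) → Fin L) := condExp_mul_eq_mul_integral_of_indep
    (iSup_comap_le hmZ) hYle (indep_of_indep_of_le_right hindep (pastFilt_le_iSup Y u))
    (hXm a).stronglyMeasurable (hVm a).stronglyMeasurable
    (integrable_of_measurable_of_abs_le (hXm₀ a) (hXb a)) (hXVi a)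
  rw [hexp]
  filter_upwards [condExp_finsetSum (m := pastFilt Y u) (s := Finset.univ) (fun a _ => hXVi a),
    ae_all_iff.2 hterm] with ω hω hω'
  rw [hω, Finset.sum_apply]
  exact Finset.sum_congr rfl fun a _ => hω' a

theorem integral_succ_mul_eq_sum {Ω : Type*} {m₀ : MeasurableSpace Ω} (P : Measure Ω)
    [IsProbabilityMeasure P] {L : ℕ}
    {Z : ℕ → Ω → (Fin L → ℝ)} (hmZ : ∀ t, Measurable (Z t))
    (hZ : ∀ t ω, ∃ i : Fin L, Z t ω = stdBasis L i)
    {Pm : Matrix (Fin L) (Fin L) ℝ} {t : ℕ} {k : Fin L}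
    (hMarkov : (P[fun ω => Z (t + 1) ω k | pastFilt Z t]) =ᵐ[P]
      fun ω => Pm.mulVec (Z t ω) k)
    {W : Ω → ℝ} (hW : Measurable[pastFilt Z t] W) (hWb : ∀ ω, |W ω| ≤ 1) :
    ∫ ω, Z (t + 1) ω k * W ω ∂P = ∑ j, Pm k j * ∫ ω, Z t ω j * W ω ∂P := by
  have hle : pastFilt Z t ≤ m₀ := (pastFilt_le_iSup Z t).trans (iSup_comap_le hmZ)
  have hmZk (s : ℕ) (j : Fin L) : Measurable fun ω => Z s ω j :=
    (measurable_pi_apply j).comp (hmZ s)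
  have hi (s : ℕ) (j : Fin L) : Integrable (fun ω => Z s ω j * W ω) P := by
    refine integrable_of_measurable_of_abs_le ((hmZk s j).mul (hW.mono hle le_rfl))
      (C := 1) fun ω => ?_
    rw [abs_mul]
    exact mul_le_one₀ (abs_apply_le_one (hZ s ω) j) (abs_nonneg _) (hWb ω)
  have hpull : P[fun ω => Z (t + 1) ω k * W ω | pastFilt Z t] =ᵐ[P]
      fun ω => (P[fun ω => Z (t + 1) ω k | pastFilt Z t]) ω * W ω :=
    condExp_mul_of_stronglyMeasurable_right hW.stronglyMeasurable (hi (t + 1) k)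
      (integrable_of_measurable_of_abs_le (hmZk (t + 1) k)
        fun ω => abs_apply_le_one (hZ (t + 1) ω) k)
  calc ∫ ω, Z (t + 1) ω k * W ω ∂P
      = ∫ ω, (P[fun ω => Z (t + 1) ω k * W ω | pastFilt Z t]) ω ∂P := (integral_condExp hle).symm
    _ = ∫ ω, ∑ j, Pm k j * (Z t ω j * W ω) ∂P := by
        refine integral_congr_ae ?_
        filter_upwards [hpull, hMarkov] with ω h₁ h₂
        rw [h₁, h₂, Matrix.mulVec, dotProduct, Finset.sum_mul]
        simp_rw [mul_assoc]
    _ = ∑ j, Pm k j * ∫ ω, Z t ω j * W ω ∂P := by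
        rw [integral_finsetSum _ fun j _ => (hi t j).const_mul _]
        simp_rw [integral_const_mul]

/-- **Theorem 3 (The Markovian Filter), core recursion.**
With `Λ_t = ∏_{s=0}^t g_s(Z_s, Y_s)` and `E_t = E[Z_t Λ_t | σ(Y_0,…,Y_t)]`, the
unnormalized filter satisfies `E_t = D_t(Y_t) Pm E_{t−1}` a.s. for `t ≥ 1`
(componentwise: `E_t(k) = g_t(e_k, Y_t) Σ_j Pm(k,j) E_{t−1}(j)`), and
`E_0 = D_0(Y_0) E[Z_0]` a.s. -/
theorem markovian_filter_recursion
    {Ω : Type*} [MeasurableSpace Ω] (P : Measure Ω) [IsProbabilityMeasure P]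
    {L N : ℕ}
    (Z : ℕ → Ω → (Fin L → ℝ)) (hmZ : ∀ t, Measurable (Z t))
    (hZbasis : ∀ t ω, ∃ i : Fin L, Z t ω = stdBasis L i)
    (Pm : Matrix (Fin L) (Fin L) ℝ)
    (hPmnonneg : ∀ i j, 0 ≤ Pm i j) (hPmcol : ∀ j, ∑ i, Pm i j = 1)
    (hMarkov : ∀ t : ℕ, ∀ k : Fin L,
      (P[fun ω => Z (t + 1) ω k | pastFilt Z t]) =ᵐ[P]
        fun ω => Pm.mulVec (Z t ω) k)
    (Y : ℕ → Ω → (Fin N → ℝ)) (hmY : ∀ t, Measurable (Y t))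
    (hindep : Indep (⨆ t : ℕ, MeasurableSpace.comap (Z t) inferInstance)
                    (⨆ t : ℕ, MeasurableSpace.comap (Y t) inferInstance) P)
    (g : ℕ → (Fin L → ℝ) → (Fin N → ℝ) → ℝ) (c : ℕ → ℝ)
    (hmg : ∀ t, Measurable (Function.uncurry (g t)))
    (hg : ∀ t z y, g t z y ∈ Set.Icc (0 : ℝ) (c t)) :
    (∀ t : ℕ, ∀ k : Fin L,
      (P[fun ω => Z (t + 1) ω k * ∏ s ∈ Finset.range (t + 2), g s (Z s ω) (Y s ω)
          | pastFilt Y (t + 1)]) =ᵐ[P]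
        fun ω => g (t + 1) (stdBasis L k) (Y (t + 1) ω) *
          ∑ j, Pm k j *
            (P[fun ω' => Z t ω' j * ∏ s ∈ Finset.range (t + 1), g s (Z s ω') (Y s ω')
                | pastFilt Y t]) ω) ∧
    (∀ k : Fin L,
      (P[fun ω => Z 0 ω k * g 0 (Z 0 ω) (Y 0 ω) | pastFilt Y 0]) =ᵐ[P]
        fun ω => g 0 (stdBasis L k) (Y 0 ω) * ∫ ω', Z 0 ω' k ∂P) := by
  have hYle (u : ℕ) := (pastFilt_le_iSup Y u).trans (iSup_comap_le hmY)
  have hmZk (s : ℕ) (j : Fin L) : Measurable fun ω => Z s ω j :=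
    (measurable_pi_apply j).comp (hmZ s)
  have hgm (t : ℕ) (k : Fin L) :
      Measurable[pastFilt Y t] fun ω => g t (stdBasis L k) (Y t ω) :=
    ((hmg t).comp measurable_prodMk_left).comp (measurable_pastFilt Y le_rfl)
  have hgabs (t : ℕ) (z : Fin L → ℝ) (y : Fin N → ℝ) : |g t z y| ≤ c t := by
    rw [abs_of_nonneg (hg t z y).1]
    exact (hg t z y).2
  refine ⟨fun t k => ?_, fun k => ?_⟩
  · have hΛm : Measurable fun ω =>
        Z (t + 1) ω k * ∏ s ∈ Finset.range (t + 1), g s (Z s ω) (Y s ω) :=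
      (hmZk (t + 1) k).mul (Finset.measurable_prod _ fun s _ =>
        (hmg s).comp ((hmZ s).prodMk (hmY s)))
    have hΛb (ω : Ω) : |Z (t + 1) ω k * ∏ s ∈ Finset.range (t + 1), g s (Z s ω) (Y s ω)|
        ≤ 1 * ∏ s ∈ Finset.range (t + 1), c s := by
      rw [abs_mul, Finset.abs_prod]
      exact mul_le_mul (abs_apply_le_one (hZbasis _ ω) k)
        (Finset.prod_le_prod (fun _ _ => abs_nonneg _) fun s _ => hgabs _ _ _)
        (Finset.prod_nonneg fun _ _ => abs_nonneg _) zero_le_one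
    have hΛi := integrable_of_measurable_of_abs_le (P := P) hΛm hΛb
    have hsplit : (fun ω => Z (t + 1) ω k *
        ∏ s ∈ Finset.range (t + 2), g s (Z s ω) (Y s ω)) =
        fun ω => g (t + 1) (stdBasis L k) (Y (t + 1) ω) *
          (Z (t + 1) ω k * ∏ s ∈ Finset.range (t + 1), g s (Z s ω) (Y s ω)) := by
      ext ω
      rw [Finset.prod_range_succ]
      linear_combination (∏ s ∈ Finset.range (t + 1), g s (Z s ω) (Y s ω)) *
        stdBasis_mul_apply (hZbasis (t + 1) ω) k fun z => g (t + 1) z (Y (t + 1) ω)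
    have hpull : P[fun ω => g (t + 1) (stdBasis L k) (Y (t + 1) ω) *
          (Z (t + 1) ω k * ∏ s ∈ Finset.range (t + 1), g s (Z s ω) (Y s ω))
          | pastFilt Y (t + 1)] =ᵐ[P]
        fun ω => g (t + 1) (stdBasis L k) (Y (t + 1) ω) *
          (P[fun ω => Z (t + 1) ω k * ∏ s ∈ Finset.range (t + 1), g s (Z s ω) (Y s ω)
            | pastFilt Y (t + 1)]) ω :=
      condExp_mul_of_stronglyMeasurable_left (hgm (t + 1) k).stronglyMeasurable
        (hΛi.bdd_mul ((hgm (t + 1) k).mono (hYle _) le_rfl).aestronglyMeasurable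
          (Filter.Eventually.of_forall fun ω => hgabs _ _ _)) hΛi
    rw [hsplit]
    filter_upwards [hpull,
      condExp_mul_prod_eq_sum_paths P hmZ hZbasis hmY hindep hmg hg t.le_succ (t + 1) k,
      ae_all_iff.2 fun j =>
        condExp_mul_prod_eq_sum_paths P hmZ hZbasis hmY hindep hmg hg (le_refl t) t j]
      with ω h₁ h₂ h₃
    rw [h₁, h₂]
    simp_rw [h₃, Finset.mul_sum]
    rw [Finset.sum_comm]
    refine Finset.sum_congr rfl fun a _ => ?_
    rw [integral_succ_mul_eq_sum P hmZ hZbasis (hMarkov t k)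
      (W := fun ω => ∏ s : Fin (t + 1), Z s ω (a s))
      (Finset.measurable_prod _ fun s _ => (measurable_pi_apply (a s)).comp
        (measurable_pastFilt Z (Nat.lt_succ_iff.mp s.2)))
      (abs_prod_paths_le_one hZbasis a), Finset.sum_mul, Finset.mul_sum]
    simp_rw [mul_assoc]
  · have hsub : (fun ω => Z 0 ω k * g 0 (Z 0 ω) (Y 0 ω)) =
        fun ω => Z 0 ω k * g 0 (stdBasis L k) (Y 0 ω) := by
      ext ω
      exact stdBasis_mul_apply (hZbasis 0 ω) k fun z => g 0 z (Y 0 ω)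
    have hZi : Integrable (fun ω => Z 0 ω k) P :=
      integrable_of_measurable_of_abs_le (hmZk 0 k) fun ω => abs_apply_le_one (hZbasis 0 ω) k
    have hZm : Measurable[pastFilt Z 0] fun ω => Z 0 ω k :=
      (measurable_pi_apply k).comp (measurable_pastFilt Z le_rfl)
    rw [hsub]
    filter_upwards [condExp_mul_eq_mul_integral_of_indep (iSup_comap_le hmZ) (hYle 0)
      (indep_of_indep_of_le_right hindep (pastFilt_le_iSup Y 0))
      (hZm.mono (pastFilt_le_iSup Z 0) le_rfl).stronglyMeasurable
      (hgm 0 k).stronglyMeasurable hZi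
      (hZi.mul_bdd ((hgm 0 k).mono (hYle 0) le_rfl).aestronglyMeasurable
        (Filter.Eventually.of_forall fun ω => hgabs _ _ _))] with ω hω
    rw [hω, mul_comm]
end

section
/- Let σ > 0 and α > 0, and let f_W(x) = φ(x/σ) 1_{[−α,α]}(x) / (σ(2Φ(α/σ) − 1)) be the zero-location truncated Gaussian density on [−α,α] with scale σ. Then for all y, m₁, m₂ ∈ ℝ, | f_W(y − m₁) − f_W(y − m₂) | ≤ f_W(α) + |m₁ − m₂| / ( σ² (2Φ(α/σ) − 1) √(2πe) ), where f_W(α) = φ(α/σ)/(σ(2Φ(α/σ) − 1)). (Key pointwise estimate in the proof of the paper's Theorem 5, Additive NARs are Almost CRT II.) -/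
open Real MeasureTheory

/-- The standard Gaussian density `φ(x) = (2π)^{−1/2} exp(−x²/2)`. -/
noncomputable def stdGaussian (x : ℝ) : ℝ :=
  (Real.sqrt (2 * Real.pi))⁻¹ * Real.exp (-(x ^ 2) / 2)

/-- The standard Gaussian cumulative distribution function `Φ`. -/
noncomputable def stdGaussianCDF (t : ℝ) : ℝ :=
  ∫ x in Set.Iic t, stdGaussian x

/-- The zero-location truncated Gaussian density on `[−α,α]` with scale `σ`:
`f_W(x) = φ(x/σ) 1_{[−α,α]}(x) / (σ(2Φ(α/σ) − 1))`. -/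
noncomputable def truncGaussian (σ α x : ℝ) : ℝ :=
  if x ∈ Set.Icc (-α) α then
    stdGaussian (x / σ) / (σ * (2 * stdGaussianCDF (α / σ) - 1))
  else 0

lemma stdGaussian_nonneg (x : ℝ) : 0 ≤ stdGaussian x := by
  unfold stdGaussian; positivity

lemma stdGaussian_neg (x : ℝ) : stdGaussian (-x) = stdGaussian x := by
  simp [stdGaussian]

lemma stdGaussian_eq (x : ℝ) :
    stdGaussian x = (√(2 * π))⁻¹ * exp (-(1 / 2) * x ^ 2) := by
  unfold stdGaussian; congr 2; ring

lemma integrable_stdGaussian : Integrable stdGaussian := by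
  simp only [funext stdGaussian_eq]
  exact (integrable_exp_neg_mul_sq (by norm_num)).const_mul _

lemma stdGaussianCDF_zero : stdGaussianCDF 0 = 1 / 2 := by
  have h : stdGaussianCDF 0 = ∫ x in Set.Ioi (0 : ℝ), stdGaussian x := by
    have := integral_comp_neg_Iic (0 : ℝ) stdGaussian
    simpa only [stdGaussianCDF, stdGaussian_neg, neg_zero] using this
  rw [h]
  simp only [stdGaussian_eq, integral_const_mul, integral_gaussian_Ioi]
  rw [show π / (1 / 2) = 2 * π by ring]
  have : √(2 * π) ≠ 0 := by positivity
  field_simp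

lemma stdGaussianCDF_mono : Monotone stdGaussianCDF := fun _ _ hst ↦
  setIntegral_mono_set integrable_stdGaussian.integrableOn
    (Filter.Eventually.of_forall stdGaussian_nonneg) (Set.Iic_subset_Iic.2 hst).eventuallyLE

lemma two_mul_stdGaussianCDF_sub_one_nonneg {t : ℝ} (ht : 0 ≤ t) :
    0 ≤ 2 * stdGaussianCDF t - 1 := by
  have := stdGaussianCDF_mono ht
  rw [stdGaussianCDF_zero] at this
  linarith

lemma hasDerivAt_stdGaussian (x : ℝ) :
    HasDerivAt stdGaussian (-x * stdGaussian x) x := by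
  have h : HasDerivAt (fun x : ℝ ↦ -(x ^ 2) / 2) (-x) x := by
    refine ((hasDerivAt_pow 2 x).neg.div_const 2).congr_deriv ?_
    norm_num
    ring
  refine (h.exp.const_mul (√(2 * π))⁻¹).congr_deriv ?_
  unfold stdGaussian; ring

lemma abs_mul_exp_neg_sq_div_two_le (x : ℝ) : |x| * exp (-(x ^ 2) / 2) ≤ (√(exp 1))⁻¹ := by
  rw [← exp_half, ← Real.exp_neg]
  have h : |x| ≤ exp ((x ^ 2 - 1) / 2) := by
    have := add_one_le_exp ((x ^ 2 - 1) / 2)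
    nlinarith [sq_nonneg (|x| - 1), sq_abs x]
  calc |x| * exp (-(x ^ 2) / 2) ≤ exp ((x ^ 2 - 1) / 2) * exp (-(x ^ 2) / 2) := by gcongr
    _ = exp (-(1 / 2)) := by rw [← Real.exp_add]; congr 1; ring

lemma abs_deriv_stdGaussian_le (x : ℝ) :
    |-x * stdGaussian x| ≤ (√(2 * π * exp 1))⁻¹ := by
  rw [abs_mul, abs_neg, abs_of_nonneg (stdGaussian_nonneg x), Real.sqrt_mul (by positivity),
    mul_inv, stdGaussian, mul_left_comm]
  gcongr
  exact abs_mul_exp_neg_sq_div_two_le x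

lemma abs_stdGaussian_sub_le (x y : ℝ) :
    |stdGaussian x - stdGaussian y| ≤ (√(2 * π * exp 1))⁻¹ * |x - y| :=
  convex_univ.norm_image_sub_le_of_norm_hasDerivWithin_le
    (fun z _ ↦ (hasDerivAt_stdGaussian z).hasDerivWithinAt)
    (fun z _ ↦ abs_deriv_stdGaussian_le z) (Set.mem_univ y) (Set.mem_univ x)

lemma stdGaussian_abs (x : ℝ) : stdGaussian |x| = stdGaussian x := by
  simp [stdGaussian]

lemma stdGaussian_div_le_of_abs_le {σ α a b : ℝ} (hσ : 0 < σ) (ha : |a| ≤ α) (hb : α ≤ |b|) :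
    stdGaussian (a / σ) ≤
      stdGaussian (α / σ) + (√(2 * π * exp 1))⁻¹ * (|a - b| / σ) := by
  have h := (le_abs_self _).trans (abs_stdGaussian_sub_le (|a| / σ) (α / σ))
  have hr : stdGaussian (|a| / σ) = stdGaussian (a / σ) := by
    rw [← stdGaussian_abs (a / σ), abs_div, abs_of_pos hσ]
  have hd : |(|a| / σ - α / σ)| ≤ |a - b| / σ := by
    rw [← sub_div, abs_div, abs_of_pos hσ, abs_sub_comm, abs_of_nonneg (sub_nonneg.2 ha)]
    refine div_le_div_of_nonneg_right ?_ hσ.le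
    have := abs_sub_abs_le_abs_sub b a
    rw [abs_sub_comm b a] at this
    linarith
  have := mul_le_mul_of_nonneg_left hd (by positivity : 0 ≤ (√(2 * π * exp 1))⁻¹)
  linarith

lemma abs_indicator_stdGaussian_div_sub_le {σ : ℝ} (hσ : 0 < σ) (α a b : ℝ) :
    |(if a ∈ Set.Icc (-α) α then stdGaussian (a / σ) else 0) -
        (if b ∈ Set.Icc (-α) α then stdGaussian (b / σ) else 0)| ≤
      stdGaussian (α / σ) + (√(2 * π * exp 1))⁻¹ * (|a - b| / σ) := by
  have hα := stdGaussian_nonneg (α / σ)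
  simp only [Set.mem_Icc, ← abs_le]
  split_ifs with ha hb hb
  · have := abs_stdGaussian_sub_le (a / σ) (b / σ)
    rw [← sub_div, abs_div, abs_of_pos hσ] at this
    linarith
  · rw [sub_zero, abs_of_nonneg (stdGaussian_nonneg _)]
    exact stdGaussian_div_le_of_abs_le hσ ha (not_le.1 hb).le
  · rw [zero_sub, abs_neg, abs_of_nonneg (stdGaussian_nonneg _), abs_sub_comm]
    exact stdGaussian_div_le_of_abs_le hσ hb (not_le.1 ha).le
  · rw [sub_zero, abs_zero]
    positivity

/-- **Key pointwise estimate in the proof of Theorem 5 (Additive NARs are almost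
CRT II):** for all `y, m₁, m₂`,
`|f_W(y − m₁) − f_W(y − m₂)| ≤ f_W(α) + |m₁ − m₂| / (σ²(2Φ(α/σ) − 1)√(2πe))`. -/
theorem truncGaussian_shift_estimate
    (σ α : ℝ) (hσ : 0 < σ) (hα : 0 < α) (y m₁ m₂ : ℝ) :
    |truncGaussian σ α (y - m₁) - truncGaussian σ α (y - m₂)| ≤
      truncGaussian σ α α +
        |m₁ - m₂| /
          (σ ^ 2 * (2 * stdGaussianCDF (α / σ) - 1) *
            Real.sqrt (2 * Real.pi * Real.exp 1)) := by
  have hc := two_mul_stdGaussianCDF_sub_one_nonneg (div_pos hα hσ).le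
  have hW (x : ℝ) : truncGaussian σ α x =
      (if x ∈ Set.Icc (-α) α then stdGaussian (x / σ) else 0) /
        (σ * (2 * stdGaussianCDF (α / σ) - 1)) := by
    rw [truncGaussian, ite_div, zero_div]
  have hdist : |m₁ - m₂| = |y - m₁ - (y - m₂)| := by
    rw [abs_sub_comm]; congr 1; ring
  rw [hW, hW, hW, if_pos (Set.mem_Icc.2 ⟨by linarith, le_rfl⟩), ← sub_div, abs_div,
    abs_of_nonneg (mul_nonneg hσ.le hc), hdist]
  refine (div_le_div_of_nonneg_right (abs_indicator_stdGaussian_div_sub_le hσ α (y - m₁) (y - m₂))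
    (mul_nonneg hσ.le hc)).trans_eq ?_
  rw [add_div]
  simp only [div_eq_mul_inv, mul_inv]
  ring
end
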